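/- Let F be a nonzero quadratic form on ℝ^m and let B ⊆ ℤ^m be a set of integer points with F(b) = 0 for all b ∈ B. Suppose B is 'dense' for quadratic forms in the sense that every quadratic form G on ℝ^m vanishing identically on B is a real scalar multiple of F. Then F is rational up to scaling: there exists a nonzero real number λ such that all coefficients of λ·F are rational. -/

import Mathlib

open Matrix

/-- Applying a `ℚ`-linear functional to the coefficients of a form commutes with evaluating the form
at an integer point. -/
lemma dotProduct_mulVec_map_rat {ι : Type*} [Fintype ι] (f : Module.Dual ℚ ℝ)
    (F : Matrix ι ι ℝ) (b : ι → ℤ) :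
    (fun i => (b i : ℝ)) ⬝ᵥ (F.map fun x => (f x : ℝ)).mulVec (fun i => (b i : ℝ)) =
      f ((fun i => (b i : ℝ)) ⬝ᵥ F.mulVec (fun i => (b i : ℝ))) := by
  have h (n : ℤ) (x : ℝ) : f (n * x) = n * f x := by
    rw [← zsmul_eq_mul, map_zsmul, zsmul_eq_mul]
  simp only [dotProduct, mulVec, Matrix.map_apply, map_sum, h, mul_comm _ (Int.cast _ : ℝ)]
  push_cast
  rfl

/-- A nonzero quadratic form (given by its symmetric coefficient matrix `F`)
vanishing on a set `B` of integer points which is dense for quadratic forms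
(any form vanishing on `B` is a scalar multiple of `F`) is rational up to
scaling: there is `λ ≠ 0` with all coefficients of `λ·F` rational. -/
theorem form_vanishing_on_dense_integer_points_is_rational (m : ℕ)
    (F : Matrix (Fin m) (Fin m) ℝ) (hFsymm : F.IsSymm) (hF : F ≠ 0)
    (B : Set (Fin m → ℤ))
    (hvanish : ∀ b ∈ B, (fun i => (b i : ℝ)) ⬝ᵥ F.mulVec (fun i => (b i : ℝ)) = 0)
    (hdense : ∀ G : Matrix (Fin m) (Fin m) ℝ, G.IsSymm →
      (∀ b ∈ B, (fun i => (b i : ℝ)) ⬝ᵥ G.mulVec (fun i => (b i : ℝ)) = 0) →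
      ∃ c : ℝ, G = c • F) :
    ∃ l : ℝ, l ≠ 0 ∧ ∀ i j, ∃ q : ℚ, l * F i j = (q : ℝ) := by
  obtain ⟨i₀, j₀, hij⟩ : ∃ i j, F i j ≠ 0 := by
    by_contra! h
    exact hF (Matrix.ext h)
  obtain ⟨f, hf⟩ : ∃ f : Module.Dual ℚ ℝ, f (F i₀ j₀) ≠ 0 := by
    by_contra! h
    exact hij ((Module.forall_dual_apply_eq_zero_iff ℚ _).1 h)
  obtain ⟨c, hc⟩ := hdense (F.map fun x => (f x : ℝ)) (hFsymm.map _) fun b hb => by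
    rw [dotProduct_mulVec_map_rat, hvanish b hb, map_zero, Rat.cast_zero]
  have hcF (i j) : c * F i j = f (F i j) := (congrFun (congrFun hc i) j).symm
  refine ⟨c, ?_, fun i j => ⟨_, hcF i j⟩⟩
  rintro rfl
  exact hf (by simpa using (hcF i₀ j₀).symm)
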